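/- Let f : S³ → S⁶ be a smooth embedding such that f(S³) ⊆ {x ∈ S⁶ : x₁ > 0} and such that there exists an isotopy between f and the standard embedding ι : S³ → S⁶, ι(x₁,x₂,x₃,x₄) = (x₁,x₂,x₃,x₄,0,0,0). Then there exists a continuous injective map φ : D⁴ → S⁶ from the closed unit ball D⁴ ⊂ ℝ⁴ such that φ(x) = f(x) for every x in the boundary sphere S³ = ∂D⁴ and φ(D⁴) ⊆ {x ∈ S⁶ : x₁ > 0}. -/

import Mathlib

/- STATEMENT 10: Let f : S³ → S⁶ be a smooth embedding with f(S³) ⊆ {x₁ > 0},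
   isotopic to the standard embedding ι(x₁,x₂,x₃,x₄) = (x₁,x₂,x₃,x₄,0,0,0).
   Then there is a continuous injective φ : D⁴ → S⁶ with φ = f on ∂D⁴ = S³ and
   φ(D⁴) ⊆ {x ∈ S⁶ : x₁ > 0}. -/

open scoped Manifold

noncomputable section

abbrev E (n : ℕ) : Type := EuclideanSpace ℝ (Fin n)
abbrev Sph (n : ℕ) : Set (E (n + 1)) := Metric.sphere 0 1

/-- A smooth embedding between spheres: a `C^∞` map which is a topological
embedding and whose differential is injective at every point. -/
def IsSmoothEmbedding {m n : ℕ} (f : Sph m → Sph n) : Prop :=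
  ContMDiff (𝓡 m) (𝓡 n) (⊤ : ℕ∞) f ∧ Topology.IsEmbedding f ∧
    ∀ x, Function.Injective (mfderiv (𝓡 m) (𝓡 n) f x)

/-- An isotopy between smooth embeddings `f g : S³ → S⁶`: a `C^∞` map
`H : [0,1] × S³ → S⁶` all of whose slices are smooth embeddings, with
`H₀ = f` and `H₁ = g`. -/
def IsIsotopy (H : Set.Icc (0 : ℝ) 1 × Sph 3 → Sph 6) (f g : Sph 3 → Sph 6) : Prop :=
  ContMDiff ((𝓡∂ 1).prod (𝓡 3)) (𝓡 6) (⊤ : ℕ∞) H ∧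
  (∀ t : Set.Icc (0 : ℝ) 1, IsSmoothEmbedding fun x => H (t, x)) ∧
  (∀ x, H (⟨0, by norm_num⟩, x) = f x) ∧
  (∀ x, H (⟨1, by norm_num⟩, x) = g x)

/-- The underlying map of the standard embedding `ι : S³ → S⁶`. -/
def iotaFun (x : E 4) : E 7 :=
  (WithLp.equiv 2 (Fin 7 → ℝ)).symm ![x 0, x 1, x 2, x 3, 0, 0, 0]

section

open Filter Topology Set Metric


theorem exists_homeomorph_of_norm_sub_sub_le (F : Type*) [NormedAddCommGroup F] [NormedSpace ℝ F]
    [FiniteDimensional ℝ F] :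
    ∃ ε : ℝ, 0 < ε ∧ ∀ {X : Type} (g h : X → F),
      (∀ a b, ‖(h a - h b) - (g a - g b)‖ ≤ ε * ‖g a - g b‖) →
      ∃ Φ : F ≃ₜ F, ∀ a, Φ (g a) = h a := by
  rcases subsingleton_or_nontrivial F with hF | hF
  · exact ⟨1, one_pos, fun g h _ => ⟨Homeomorph.refl F, fun a => Subsingleton.elim _ _⟩⟩
  set e := ContinuousLinearEquiv.refl ℝ F
  have hL : 0 < lipschitzExtensionConstant F := lipschitzExtensionConstant_pos F
  have hN : 0 < ‖(e.symm : F →L[ℝ] F)‖₊ := by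
    rw [← NNReal.coe_pos]; exact e.norm_symm_pos
  obtain ⟨c, hc0, hc⟩ : ∃ c : NNReal, 0 < c ∧
      lipschitzExtensionConstant F * c < ‖(e.symm : F →L[ℝ] F)‖₊⁻¹ := by
    refine ⟨(lipschitzExtensionConstant F)⁻¹ * (‖(e.symm : F →L[ℝ] F)‖₊⁻¹ / 2), by positivity, ?_⟩
    rw [← mul_assoc, mul_inv_cancel₀ hL.ne', one_mul]
    exact NNReal.half_lt_self (by positivity)
  refine ⟨c, hc0, fun {X} g h hgh => ?_⟩
  have hinj : ∀ a b, g a = g b → h a = h b := by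
    intro a b hab
    have := hgh a b
    rw [hab] at this
    simpa [sub_eq_zero] using this
  have hfac : ∀ a, Function.extend g h id (g a) = h a := fun a =>
    Function.FactorsThrough.extend_apply (fun a b hab => hinj a b hab) _ a
  have happ : ApproximatesLinearOn (Function.extend g h id) (e : F →L[ℝ] F) (range g) c := by
    rintro _ ⟨a, rfl⟩ _ ⟨b, rfl⟩
    simpa [hfac, e] using hgh a b
  obtain ⟨Φ, hΦ⟩ := happ.exists_homeomorph_extension (Or.inr hc)
  exact ⟨Φ, fun a => (hΦ ⟨a, rfl⟩).symm.trans (hfac a)⟩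

/-- Radial compression of the whole space into a ball, fixing a given compact subset. -/
theorem exists_continuous_injective_mem_ball {F : Type*} [NormedAddCommGroup F] [NormedSpace ℝ F]
    [ProperSpace F] {K : Set F} (hK : IsCompact K) {c : F} {R : ℝ} (hKR : K ⊆ ball c R) (hR : 0 < R) :
    ∃ C : F → F, Continuous C ∧ Function.Injective C ∧ (∀ x, C x ∈ ball c R) ∧
      ∀ x ∈ K, C x = x := by
  obtain ⟨r, hrR, hr⟩ := exists_lt_subset_ball hK.isClosed hKR
  have hpos : ∀ s : ℝ, 0 < R + max s r - r := fun s => by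
    have := le_max_right s r
    linarith
  have hnorm : ∀ x, ‖(R / (R + max ‖x - c‖ r - r)) • (x - c)‖
      = R / (R + max ‖x - c‖ r - r) * ‖x - c‖ := fun x => by
    rw [norm_smul, Real.norm_of_nonneg (div_pos hR (hpos _)).le]
  refine ⟨fun x => c + (R / (R + max ‖x - c‖ r - r)) • (x - c), ?_, ?_, ?_, ?_⟩
  · refine continuous_const.add (Continuous.smul (continuous_const.div (by fun_prop) ?_)
      (by fun_prop))
    exact fun x => (hpos _).ne'
  · intro x y hxy
    have hxy : (R / (R + max ‖x - c‖ r - r)) • (x - c)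
        = (R / (R + max ‖y - c‖ r - r)) • (y - c) := add_left_cancel hxy
    have key : ∀ s s' : ℝ, 0 ≤ s → s < s' →
        R / (R + max s r - r) * s ≠ R / (R + max s' r - r) * s' := by
      intro s s' hs hss h
      have h1 := hpos s
      have h2 := hpos s'
      field_simp at h
      rcases le_total s r with h3 | h3 <;> rcases le_total s' r with h4 | h4 <;>
        simp only [h3, h4, max_eq_left, max_eq_right] at h <;> nlinarith
    have hn := congrArg norm hxy
    rw [hnorm, hnorm] at hn
    have heq : ‖x - c‖ = ‖y - c‖ := by
      rcases lt_trichotomy ‖x - c‖ ‖y - c‖ with h | h | h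
      · exact absurd hn (key _ _ (norm_nonneg _) h)
      · exact h
      · exact absurd hn.symm (key _ _ (norm_nonneg _) h)
    rw [heq] at hxy
    simpa using smul_right_injective F (div_pos hR (hpos _)).ne' hxy
  · intro x
    rw [mem_ball_iff_norm, add_sub_cancel_left, hnorm, div_mul_eq_mul_div, div_lt_iff₀ (hpos _)]
    have := le_max_left ‖x - c‖ r
    nlinarith
  · intro x hx
    have := hr hx
    rw [mem_ball_iff_norm] at this
    simp [max_eq_right this.le, hR.ne']

theorem HasStrictFDerivAt.eventually_mul_norm_sub_le {V F W : Type*}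
    [NormedAddCommGroup V] [NormedSpace ℝ V] [FiniteDimensional ℝ V]
    [NormedAddCommGroup F] [NormedSpace ℝ F] [NormedAddCommGroup W] [NormedSpace ℝ W]
    {g : V → F} {L : V →L[ℝ] F} {N : V → W} {N' : V →L[ℝ] W} {x : V}
    (hg : HasStrictFDerivAt g L x) (hN : HasStrictFDerivAt N N' x)
    (hinj : ∀ v, L v = 0 → N' v = 0 → v = 0) :
    ∃ c : ℝ, 0 < c ∧ ∀ᶠ p : V × V in 𝓝 (x, x), N p.1 = N p.2 →
      c * ‖p.1 - p.2‖ ≤ ‖g p.1 - g p.2‖ := by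
  obtain ⟨K, hK, hanti⟩ := LinearMap.exists_antilipschitzWith (L.prod N').toLinearMap (by
    rw [LinearMap.ker_eq_bot']
    intro v hv
    have hv : (L v, N' v) = (0, 0) := hv
    exact hinj v (congrArg Prod.fst hv) (congrArg Prod.snd hv))
  have hK' : (0 : ℝ) < K := hK
  refine ⟨(K : ℝ)⁻¹ / 2, by positivity, ?_⟩
  have hs := (hg.prodMk hN).isLittleO.def (c := (K : ℝ)⁻¹ / 2) (by positivity)
  filter_upwards [hs] with p hp hNp
  have h1 := hanti.le_mul_dist (p.1 - p.2) 0
  rw [dist_zero_right, map_zero, dist_zero_right] at h1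
  set u := (L.prod N') (p.1 - p.2)
  have h1 : ‖p.1 - p.2‖ ≤ K * ‖u‖ := h1
  set w := ((g p.1, N p.1) - (g p.2, N p.2) : F × W)
  have h2 : ‖w‖ = ‖g p.1 - g p.2‖ := by
    simp [w, hNp, Prod.norm_def]
  have h3 : ‖u‖ - ‖w‖ ≤ ‖w - u‖ := by
    rw [norm_sub_rev w]; exact norm_sub_norm_le u w
  have h4 : (K : ℝ)⁻¹ * ‖p.1 - p.2‖ ≤ ‖u‖ := by
    rw [inv_mul_le_iff₀ hK']; exact h1
  have hp : ‖w - u‖ ≤ (K : ℝ)⁻¹ / 2 * ‖p.1 - p.2‖ := hp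
  rw [← h2]
  linarith

theorem IsCompact.exists_mul_norm_sub_le {V F : Type*}
    [NormedAddCommGroup V] [NormedAddCommGroup F] {g : V → F} {K : Set V} (hK : IsCompact K)
    (hc : ∀ x ∈ K, ContinuousAt g x) (hinj : InjOn g K)
    (hloc : ∀ x ∈ K, ∃ c : ℝ, 0 < c ∧ ∀ᶠ p : V × V in 𝓝 (x, x), p.1 ∈ K → p.2 ∈ K →
      c * ‖p.1 - p.2‖ ≤ ‖g p.1 - g p.2‖) :
    ∃ c : ℝ, 0 < c ∧ ∀ a ∈ K, ∀ b ∈ K, c * ‖a - b‖ ≤ ‖g a - g b‖ := by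
  have key : ∀ᶠ c : ℝ in 𝓝 0, ∀ p ∈ K ×ˢ K, p.1 ∈ K → p.2 ∈ K →
      c * ‖p.1 - p.2‖ ≤ ‖g p.1 - g p.2‖ := by
    refine (hK.prod hK).eventually_forall_of_forall_eventually ?_
    rintro ⟨x, y⟩ ⟨hx, hy⟩
    by_cases hxy : x = y
    · subst hxy
      obtain ⟨c, hc0, hc⟩ := hloc x hx
      rw [nhds_prod_eq (x := (0 : ℝ))]
      filter_upwards [(eventually_lt_nhds hc0).prod_mk hc] with ⟨d, p⟩ ⟨hd, hp⟩ h1 h2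
      exact (mul_le_mul_of_nonneg_right (le_of_lt hd) (norm_nonneg _)).trans (hp h1 h2)
    · have hlt : (0 : ℝ) * ‖x - y‖ < ‖g x - g y‖ := by
        rw [zero_mul, norm_pos_iff, sub_ne_zero]
        exact fun h => hxy (hinj hx hy h)
      have h1 : ContinuousAt (fun z : ℝ × V × V => z.1 * ‖z.2.1 - z.2.2‖) (0, x, y) := by fun_prop
      have h2 : ContinuousAt (fun z : ℝ × V × V => ‖g z.2.1 - g z.2.2‖) (0, x, y) := by
        refine ContinuousAt.norm (ContinuousAt.sub ?_ ?_)
        · exact ContinuousAt.comp' (f := fun z : ℝ × V × V => z.2.1) (hc x hx) (by fun_prop)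
        · exact ContinuousAt.comp' (f := fun z : ℝ × V × V => z.2.2) (hc y hy) (by fun_prop)
      filter_upwards [h1.eventually_lt h2 hlt] with z hz _ _
      exact hz.le
  obtain ⟨c, hc, hc0⟩ := ((key.filter_mono nhdsWithin_le_nhds).and
    (self_mem_nhdsWithin (s := Ioi (0 : ℝ)))).exists
  exact ⟨c, hc0, fun a ha b hb => hc (a, b) ⟨ha, hb⟩ ha hb⟩

theorem IsCompact.eventually_norm_sub_sub_le {T V F : Type*}
    [NormedAddCommGroup T] [NormedSpace ℝ T] [NormedAddCommGroup V] [NormedSpace ℝ V]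
    [NormedAddCommGroup F] [NormedSpace ℝ F] {G : T × V → F} {K : Set V} (hK : IsCompact K)
    {G' : T × V → T × V →L[ℝ] F} {s : T}
    (hG : ∀ x ∈ K, HasStrictFDerivAt G (G' (s, x)) (s, x)) {ε : ℝ} (hε : 0 < ε) :
    ∀ᶠ t in 𝓝 s, ∀ a ∈ K, ∀ b ∈ K,
      ‖(G (t, a) - G (t, b)) - (G (s, a) - G (s, b))‖ ≤ ε * ‖a - b‖ := by
  have key : ∀ᶠ t in 𝓝 s, ∀ p ∈ K ×ˢ K,
      ‖(G (t, p.1) - G (t, p.2)) - (G (s, p.1) - G (s, p.2))‖ ≤ ε * ‖p.1 - p.2‖ := by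
    refine (hK.prod hK).eventually_forall_of_forall_eventually ?_
    rintro ⟨x, y⟩ ⟨hx, hy⟩
    by_cases hxy : x = y
    · subst hxy
      have h := (hG x hx).isLittleO.def (half_pos hε)
      have h1 : Tendsto (fun z : T × V × V => ((z.1, z.2.1), (z.1, z.2.2))) (𝓝 (s, x, x))
          (𝓝 ((s, x), (s, x))) := Continuous.tendsto (by fun_prop) _
      have h2 : Tendsto (fun z : T × V × V => ((s, z.2.1), (s, z.2.2))) (𝓝 (s, x, x))
          (𝓝 ((s, x), (s, x))) := Continuous.tendsto
            (f := fun z : T × V × V => ((s, z.2.1), (s, z.2.2))) (by fun_prop) (s, x, x)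
      filter_upwards [h1.eventually h, h2.eventually h] with ⟨t, a, b⟩ e1 e2
      simp only [Prod.mk_sub_mk, sub_self, Prod.norm_mk, norm_zero, norm_nonneg, sup_of_le_right]
        at e1 e2 ⊢
      calc _ = ‖(G (t, a) - G (t, b) - G' (s, x) (0, a - b))
            - (G (s, a) - G (s, b) - G' (s, x) (0, a - b))‖ := by congr 1; abel
        _ ≤ _ := norm_sub_le _ _
        _ ≤ _ := by linarith
    · have hc : ∀ x ∈ K, ContinuousAt G (s, x) := fun x hx => (hG x hx).continuousAt
      have hlt : ‖(G (s, x) - G (s, y)) - (G (s, x) - G (s, y))‖ < ε * ‖x - y‖ := by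
        rw [sub_self, norm_zero]
        exact mul_pos hε (norm_pos_iff.2 (sub_ne_zero.2 hxy))
      have h1 : ContinuousAt (fun z : T × V × V =>
          ‖(G (z.1, z.2.1) - G (z.1, z.2.2)) - (G (s, z.2.1) - G (s, z.2.2))‖) (s, x, y) := by
        refine ContinuousAt.norm (((ContinuousAt.sub ?_ ?_)).sub (ContinuousAt.sub ?_ ?_))
        · exact ContinuousAt.comp' (f := fun z : T × V × V => (z.1, z.2.1)) (hc x hx) (by fun_prop)
        · exact ContinuousAt.comp' (f := fun z : T × V × V => (z.1, z.2.2)) (hc y hy) (by fun_prop)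
        · exact ContinuousAt.comp' (f := fun z : T × V × V => (s, z.2.1)) (hc x hx) (by fun_prop)
        · exact ContinuousAt.comp' (f := fun z : T × V × V => (s, z.2.2)) (hc y hy) (by fun_prop)
      have h2 : ContinuousAt (fun z : T × V × V => ε * ‖z.2.1 - z.2.2‖) (s, x, y) := by fun_prop
      filter_upwards [h1.eventually_lt h2 hlt] with z hz
      exact hz.le
  filter_upwards [key] with t ht a ha b hb
  exact ht (a, b) ⟨ha, hb⟩

/-- Isotopy extension in the bi-Lipschitz category: the slices of a strictly differentiable family
of injective immersions of a compact set `K` are related by ambient homeomorphisms. Here `N` is a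
function that is constant on `K`, so that only vectors killed by `N'` are tested. -/
theorem exists_homeomorph_of_isotopy {T V F W : Type} [NormedAddCommGroup T] [NormedSpace ℝ T]
    [NormedAddCommGroup V] [NormedSpace ℝ V] [FiniteDimensional ℝ V]
    [NormedAddCommGroup F] [NormedSpace ℝ F] [FiniteDimensional ℝ F]
    [NormedAddCommGroup W] [NormedSpace ℝ W]
    {G : T × V → F} {K : Set V} (hK : IsCompact K) {G' : T × V → T × V →L[ℝ] F}
    (hG : ∀ t, ∀ x ∈ K, HasStrictFDerivAt G (G' (t, x)) (t, x))
    (hinj : ∀ t, InjOn (fun x => G (t, x)) K)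
    {N : V → W} {N' : V → V →L[ℝ] W} (hN : ∀ x ∈ K, HasStrictFDerivAt N (N' x) x)
    (hNK : ∀ x ∈ K, ∀ y ∈ K, N x = N y)
    (himm : ∀ t, ∀ x ∈ K, ∀ v, G' (t, x) (0, v) = 0 → N' x v = 0 → v = 0) (s t : T) :
    ∃ Φ : F ≃ₜ F, ∀ x ∈ K, Φ (G (s, x)) = G (t, x) := by
  let P : T → T → Prop := fun s t => ∃ Φ : F ≃ₜ F, ∀ x ∈ K, Φ (G (s, x)) = G (t, x)
  have hsymm : Std.Symm P := ⟨fun s t ⟨Φ, h⟩ => ⟨Φ.symm, fun x hx => by rw [← h x hx]; simp⟩⟩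
  have htrans : IsTrans T P := ⟨fun s t u ⟨Φ, h⟩ ⟨Ψ, h'⟩ =>
    ⟨Φ.trans Ψ, fun x hx => by simp [h x hx, h' x hx]⟩⟩
  refine PreconnectedSpace.induction₂ P (fun s => ?_) htrans s t
  obtain ⟨ε, hε, hext⟩ := exists_homeomorph_of_norm_sub_sub_le F
  have hslice : ∀ x ∈ K, HasStrictFDerivAt (fun y => G (s, y))
      ((G' (s, x)).comp (ContinuousLinearMap.inr ℝ T V)) x := fun x hx =>
    HasStrictFDerivAt.comp x (f := fun y => (s, y)) (hG s x hx) 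
      ((hasStrictFDerivAt_const s x).prodMk (hasStrictFDerivAt_id x))
  obtain ⟨c, hc0, hc⟩ := hK.exists_mul_norm_sub_le (fun x hx => (hslice x hx).continuousAt)
    (hinj s) (fun x hx => by
      obtain ⟨c, hc0, hc⟩ := (hslice x hx).eventually_mul_norm_sub_le (hN x hx)
        (fun v hv => himm s x hx v (by simpa using hv))
      exact ⟨c, hc0, hc.mono fun p hp h1 h2 => hp (hNK _ h1 _ h2)⟩)
  filter_upwards [hK.eventually_norm_sub_sub_le (hG s) (mul_pos hε hc0)] with t ht
  obtain ⟨Φ, hΦ⟩ := hext (fun x : K => G (s, x)) (fun x : K => G (t, x)) (fun a b => by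
    have h1 := ht a a.2 b b.2
    have h2 := hc a a.2 b b.2
    have h2 := mul_le_mul_of_nonneg_left h2 hε.le
    linarith)
  exact ⟨Φ, fun x hx => hΦ ⟨x, hx⟩⟩

/-- Under stereographic projection from a point of the open lower hemisphere, the open upper
hemisphere becomes a ball. -/
theorem exists_mem_ball_iff_pos_stereoInvFun {v : E 7} (hv : ‖v‖ = 1) (hv0 : v 0 < 0) :
    ∃ (c : (ℝ ∙ v)ᗮ) (R : ℝ), 0 < R ∧
      ∀ w, w ∈ ball c R ↔ 0 < (stereoInvFun hv w : E 7) 0 := by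
  set p : (ℝ ∙ v)ᗮ := (ℝ ∙ v)ᗮ.orthogonalProjectionOnto (EuclideanSpace.single 0 1 : E 7)
  have hp : ∀ w : (ℝ ∙ v)ᗮ, (w : E 7) 0 = inner ℝ w p := by
    intro w
    have := Submodule.inner_orthogonalProjectionOnto_eq_of_mem_left w
      (EuclideanSpace.single 0 1 : E 7)
    rw [this]
    simp [EuclideanSpace.inner_single_right]
  have hb : 0 < - v 0 := by linarith
  set b := - v 0
  have hv0' : v 0 = - b := by simp [b]
  refine ⟨(2 / b) • p, √(4 + (2 / b * ‖p‖) ^ 2), Real.sqrt_pos.2 (by positivity), fun w => ?_⟩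
  rw [mem_ball_iff_norm, Real.lt_sqrt (norm_nonneg _), norm_sub_sq_real, norm_smul,
    real_inner_smul_right, ← hp, Real.norm_of_nonneg (by positivity), stereoInvFun_apply]
  simp only [PiLp.smul_apply, PiLp.add_apply, smul_eq_mul, hv0']
  rw [mul_pos_iff_of_pos_left (by positivity)]
  have : 2 * (2 / b * (w : E 7) 0) = 4 * (w : E 7) 0 / b := by ring
  rw [this]
  have e : 4 * (w : E 7) 0 / b * b = 4 * (w : E 7) 0 := by field_simp
  constructor <;> intro h <;> nlinarith

theorem norm_iotaFun (x : E 4) : ‖iotaFun x‖ = ‖x‖ := by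
  simp [EuclideanSpace.norm_eq, iotaFun, Fin.sum_univ_succ]

theorem exists_disk_iotaFun {q : E 7} (hq : ∀ x ∈ Sph 3, iotaFun x ≠ q) :
    ∃ d : closedBall (0 : E 4) 1 → E 7, Continuous d ∧ Function.Injective d ∧
      (∀ x, d x ∈ sphere (0 : E 7) 1 ∧ d x ≠ q) ∧
      ∀ x : closedBall (0 : E 4) 1, (x : E 4) ∈ Sph 3 → d x = iotaFun x := by
  obtain ⟨ε, hε, hεq⟩ : ∃ ε : ℝ, ε ^ 2 = 1 ∧ ∀ s, 0 < s → q 4 ≠ ε * s := by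
    rcases le_or_gt 0 (q 4) with h | h
    · exact ⟨-1, by norm_num, fun s hs => by linarith⟩
    · exact ⟨1, by norm_num, fun s hs => by linarith⟩
  have hd : ∀ x : closedBall (0 : E 4) 1, 0 ≤ 1 - ‖(x : E 4)‖ ^ 2 := fun x => by
    have := mem_closedBall_zero_iff.1 x.2
    nlinarith [norm_nonneg (x : E 4)]
  let d : closedBall (0 : E 4) 1 → E 7 := fun x =>
    WithLp.toLp 2 ![x.1 0, x.1 1, x.1 2, x.1 3, ε * √(1 - ‖(x : E 4)‖ ^ 2), 0, 0]
  have hbd : ∀ x : closedBall (0 : E 4) 1, (x : E 4) ∈ Sph 3 → d x = iotaFun x := by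
    intro x hx
    have hx : ‖(x : E 4)‖ = 1 := by simpa using hx
    simp [d, hx, iotaFun]
  refine ⟨d, ?_, ?_, ?_, hbd⟩
  · refine (PiLp.continuous_toLp 2 _).comp (continuous_pi fun i => ?_)
    fin_cases i <;> simp <;> fun_prop
  · intro x y hxy
    have h : ∀ i, d x i = d y i := fun i => by rw [hxy]
    ext i
    fin_cases i
    · exact h 0
    · exact h 1
    · exact h 2
    · exact h 3
  · intro x
    have hsq : (ε * √(1 - ‖(x : E 4)‖ ^ 2)) ^ 2 = 1 - ‖(x : E 4)‖ ^ 2 := by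
      rw [mul_pow, hε, Real.sq_sqrt (hd x), one_mul]
    constructor
    · rw [mem_sphere_zero_iff_norm, EuclideanSpace.norm_eq, Real.sqrt_eq_one]
      have h4 := EuclideanSpace.real_norm_sq_eq (x : E 4)
      simp only [Fin.sum_univ_succ, Real.norm_eq_abs, sq_abs] at h4 ⊢
      simp [d] at h4 ⊢
      simp [hsq] at h4 ⊢
      linarith
    · intro hdq
      rcases (hd x).eq_or_lt with h0 | h0
      · have hx : (x : E 4) ∈ Sph 3 := by
          rw [mem_sphere_zero_iff_norm]
          nlinarith [norm_nonneg (x : E 4)]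
        exact hq x hx ((hbd x hx).symm.trans hdq)
      · refine hεq _ (Real.sqrt_pos.2 h0) ?_
        rw [← hdq]
        rfl

theorem contMDiff_coe_Sph (n : ℕ) :
    ContMDiff (𝓡 n) 𝓘(ℝ, E (n + 1)) 1 ((↑) : Sph n → E (n + 1)) :=
  have := Fact.mk (@finrank_euclideanSpace_fin ℝ _ (n + 1))
  contMDiff_coe_sphere

theorem mfderiv_coe_Sph_injective {n : ℕ} (x : Sph n) :
    Function.Injective (mfderiv (𝓡 n) 𝓘(ℝ, E (n + 1)) ((↑) : Sph n → E (n + 1)) x) :=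
  have := Fact.mk (@finrank_euclideanSpace_fin ℝ _ (n + 1))
  injective_mvfderiv_subtypeVal_sphere (n := n) x

theorem exists_mfderiv_coe_Sph_eq {n : ℕ} (x : Sph n) {v : E (n + 1)}
    (hv : inner ℝ (x : E (n + 1)) v = 0) :
    ∃ w : TangentSpace (𝓡 n) x,
      mfderiv (𝓡 n) 𝓘(ℝ, E (n + 1)) ((↑) : Sph n → E (n + 1)) x w = v := by
  have := Fact.mk (@finrank_euclideanSpace_fin ℝ _ (n + 1))
  have h := range_mvfderiv_subtypeVal (n := n) x
  exact (h ▸ Submodule.mem_orthogonal_singleton_iff_inner_right.2 hv :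
    v ∈ (mvfderiv (𝓡 n) ((↑) : Sph n → E (n + 1)) x).range)

/-- A `C¹` family over `ℝ` of punctured 4-space misses a point of the open lower hemisphere. -/
theorem exists_norm_eq_one_forall_ne {T : ℝ × E 4 → E 7}
    (hT : ∀ t x, x ≠ 0 → ContDiffAt ℝ 1 T (t, x)) :
    ∃ q : E 7, ‖q‖ = 1 ∧ q 0 < 0 ∧ ∀ t x, x ≠ 0 → T (t, x) ≠ q := by
  set U : Set (ℝ × ℝ × E 4) := {z | z.2.2 ≠ 0}
  set R : ℝ × ℝ × E 4 → E 7 := fun z => z.1 • T z.2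
  have hR : ∀ z ∈ U, ContDiffAt ℝ 1 R z := fun z hz =>
    contDiffAt_fst.smul (ContDiffAt.comp z (hT z.2.1 z.2.2 hz) contDiffAt_snd)
  have hdim : dimH (R '' U) < Module.finrank ℝ (E 7) := by
    calc dimH (R '' U) ≤ dimH U := dimH_image_le_of_locally_lipschitzOn fun z hz => by
          obtain ⟨C, t, ht, hC⟩ := (hR z hz).exists_lipschitzOnWith
          exact ⟨C, t, mem_nhdsWithin_of_mem_nhds ht, hC⟩
      _ ≤ dimH (univ : Set (ℝ × ℝ × E 4)) := dimH_mono (subset_univ _)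
      _ = Module.finrank ℝ (ℝ × ℝ × E 4) := Real.dimH_univ_eq_finrank _
      _ < Module.finrank ℝ (E 7) := by
        simp only [Module.finrank_prod, Module.finrank_self, finrank_euclideanSpace,
          Fintype.card_fin]
        norm_num
  have hopen : IsOpen {y : E 7 | y 0 < 0} :=
    isOpen_lt (by fun_prop) continuous_const
  obtain ⟨y, hy0, hy⟩ := (dense_compl_of_dimH_lt_finrank hdim).inter_open_nonempty _ hopen
    ⟨EuclideanSpace.single 0 (-1), by simp⟩
  have hy0 : y 0 < 0 := hy0
  have hyn : 0 < ‖y‖ := norm_pos_iff.2 (by rintro rfl; simp at hy0)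
  refine ⟨‖y‖⁻¹ • y, by rw [norm_smul, norm_inv, norm_norm, inv_mul_cancel₀ hyn.ne'], ?_, ?_⟩
  · exact mul_neg_of_pos_of_neg (inv_pos.2 hyn) hy0
  · intro t x hx h
    refine hy ⟨(‖y‖, t, x), hx, ?_⟩
    simp only [R]
    rw [h, smul_inv_smul₀ hyn.ne']

/-- Radial projection onto the unit sphere. -/
def sphereProj (x₀ : Sph 3) (x : E 4) : Sph 3 :=
  if hx : x = 0 then x₀ else ⟨‖x‖⁻¹ • x, by
    rw [mem_sphere_zero_iff_norm, norm_smul, norm_inv, norm_norm,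
      inv_mul_cancel₀ (norm_ne_zero_iff.2 hx)]⟩

theorem sphereProj_coe (x₀ x : Sph 3) : sphereProj x₀ x = x := by
  have hx : ‖(x : E 4)‖ = 1 := by simp
  have hx0 : (x : E 4) ≠ 0 := norm_ne_zero_iff.1 (by rw [hx]; exact one_ne_zero)
  ext1
  rw [sphereProj, dif_neg hx0]
  simp [hx]

theorem contMDiffAt_sphereProj (x₀ : Sph 3) {x : E 4} (hx : x ≠ 0) :
    ContMDiffAt 𝓘(ℝ, E 4) (𝓡 3) 1 (sphereProj x₀) x := by
  let U : TopologicalSpace.Opens (E 4) := ⟨{0}ᶜ, isOpen_compl_singleton⟩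
  have hsm : ContMDiff 𝓘(ℝ, E 4) 𝓘(ℝ, E 4) 1 (fun y : U => ‖(y : E 4)‖⁻¹ • (y : E 4)) := by
    intro y
    refine (contMDiffAt_subtype_iff (f := fun y : E 4 => ‖y‖⁻¹ • y)).2 ?_
    have hy : (y : E 4) ≠ 0 := y.2
    exact (((contDiffAt_norm ℝ hy).inv (norm_ne_zero_iff.2 hy)).smul contDiffAt_id).contMDiffAt
  have hmem : ∀ y : U, ‖(y : E 4)‖⁻¹ • (y : E 4) ∈ sphere (0 : E 4) 1 := fun y => by
    have hy : (y : E 4) ≠ 0 := y.2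
    rw [mem_sphere_zero_iff_norm, norm_smul, norm_inv, norm_norm,
      inv_mul_cancel₀ (norm_ne_zero_iff.2 hy)]
  have := Fact.mk (@finrank_euclideanSpace_fin ℝ _ (3 + 1))
  have h : ContMDiff 𝓘(ℝ, E 4) (𝓡 3) 1 (Set.codRestrict _ _ hmem : U → Sph 3) :=
    hsm.codRestrict_sphere (n := 3) hmem
  refine (contMDiffAt_subtype_iff (x := (⟨x, hx⟩ : U))).1 ?_
  refine (h ⟨x, hx⟩).congr_of_eventuallyEq (Eventually.of_forall fun y => ?_)
  have hy : (y : E 4) ≠ 0 := y.2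
  simp only [sphereProj, dif_neg hy]
  rfl

/-- The family `H` of maps of spheres, reparametrized smoothly by all of `ℝ` and extended radially
to punctured 4-space. -/
def isotopyExtension (H : Set.Icc (0 : ℝ) 1 × Sph 3 → Sph 6) (x₀ : Sph 3) (p : ℝ × E 4) : E 7 :=
  H (projIcc 0 1 zero_le_one (Real.smoothTransition p.1), sphereProj x₀ p.2)

theorem contDiffAt_isotopyExtension {H : Set.Icc (0 : ℝ) 1 × Sph 3 → Sph 6}
    (hH : ContMDiff ((𝓡∂ 1).prod (𝓡 3)) (𝓡 6) 1 H) (x₀ : Sph 3) (t : ℝ) {x : E 4} (hx : x ≠ 0) :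
    ContDiffAt ℝ 1 (isotopyExtension H x₀) (t, x) := by
  rw [← contMDiffAt_iff_contDiffAt]
  have h1 : ContMDiff 𝓘(ℝ, ℝ) (𝓡∂ 1) 1
      (fun t => projIcc (0 : ℝ) 1 zero_le_one (Real.smoothTransition t)) := by
    rw [← contMDiffOn_univ]
    refine (contMDiffOn_projIcc (x := 0) (y := 1) (n := 1)).comp
      (Real.smoothTransition.contDiff (n := 1)).contMDiff.contMDiffOn fun t _ => ?_
    exact ⟨Real.smoothTransition.nonneg t, Real.smoothTransition.le_one t⟩
  have h2 : ContMDiffAt 𝓘(ℝ, ℝ × E 4) (𝓡∂ 1) 1 (fun p : ℝ × E 4 =>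
      projIcc (0 : ℝ) 1 zero_le_one (Real.smoothTransition p.1)) (t, x) :=
    (h1 t).comp (t, x) (contDiff_fst.contMDiff (t, x))
  have h3 : ContMDiffAt 𝓘(ℝ, ℝ × E 4) (𝓡 3) 1 (fun p : ℝ × E 4 => sphereProj x₀ p.2) (t, x) :=
    ContMDiffAt.comp (t, x) (f := fun p : ℝ × E 4 => p.2) (contMDiffAt_sphereProj x₀ hx)
      (contDiff_snd.contMDiff (t, x))
  exact ContMDiffAt.comp (t, x) (g := fun y : Sph 6 => (y : E 7)) (contMDiff_coe_Sph 6 _)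
    (ContMDiffAt.comp (t, x) (hH _) (h2.prodMk h3))

theorem isotopyExtension_coe (H : Set.Icc (0 : ℝ) 1 × Sph 3 → Sph 6) (x₀ : Sph 3) (t : ℝ)
    (x : Sph 3) : isotopyExtension H x₀ (t, x) =
      H (projIcc 0 1 zero_le_one (Real.smoothTransition t), x) := by
  simp only [isotopyExtension, sphereProj_coe]

theorem coe_sphere_ne_zero (x : Sph 3) : (x : E 4) ≠ 0 :=
  ne_zero_of_mem_unit_sphere x

theorem eq_zero_of_fderiv_isotopyExtension {H : Set.Icc (0 : ℝ) 1 × Sph 3 → Sph 6}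
    (hH : ContMDiff ((𝓡∂ 1).prod (𝓡 3)) (𝓡 6) 1 H)
    (hemb : ∀ t, IsSmoothEmbedding fun x => H (t, x)) (x₀ : Sph 3) (t : ℝ) (x : Sph 3) {v : E 4}
    (hv : fderiv ℝ (isotopyExtension H x₀) (t, x) (0, v) = 0) (hxv : inner ℝ (x : E 4) v = 0) :
    v = 0 := by
  set T := isotopyExtension H x₀
  set s := projIcc (0 : ℝ) 1 zero_le_one (Real.smoothTransition t)
  obtain ⟨w, hw⟩ := exists_mfderiv_coe_Sph_eq x hxv
  have hT : HasFDerivAt (fun y : E 4 => T (t, y))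
      ((fderiv ℝ T (t, x)).comp (ContinuousLinearMap.inr ℝ ℝ (E 4))) x :=
    HasFDerivAt.comp (x : E 4) (f := fun y : E 4 => (t, y))
      ((contDiffAt_isotopyExtension hH x₀ t (coe_sphere_ne_zero x)).differentiableAt
        one_ne_zero).hasFDerivAt
      ((hasFDerivAt_const t (x : E 4)).prodMk (hasFDerivAt_id (x : E 4)))
  have hcoe : HasMFDerivAt (𝓡 3) 𝓘(ℝ, E 4) ((↑) : Sph 3 → E 4) x
      (mfderiv (𝓡 3) 𝓘(ℝ, E 4) ((↑) : Sph 3 → E 4) x) :=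
    ((contMDiff_coe_Sph 3 x).mdifferentiableAt one_ne_zero).hasMFDerivAt
  have hHs : HasMFDerivAt (𝓡 3) (𝓡 6) (fun y => H (s, y)) x
      (mfderiv (𝓡 3) (𝓡 6) (fun y => H (s, y)) x) :=
    (((hemb s).1 x).mdifferentiableAt (by simp)).hasMFDerivAt
  have hcoe6 : HasMFDerivAt (𝓡 6) 𝓘(ℝ, E 7) ((↑) : Sph 6 → E 7) (H (s, x))
      (mfderiv (𝓡 6) 𝓘(ℝ, E 7) ((↑) : Sph 6 → E 7) (H (s, x))) :=
    ((contMDiff_coe_Sph 6 _).mdifferentiableAt one_ne_zero).hasMFDerivAt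
  have e1 := HasMFDerivAt.comp x hT.hasMFDerivAt hcoe
  have e2 := HasMFDerivAt.comp x hcoe6 hHs
  have heq : (fun y : E 4 => T (t, y)) ∘ ((↑) : Sph 3 → E 4)
      = ((↑) : Sph 6 → E 7) ∘ fun y => H (s, y) := by
    funext y
    exact isotopyExtension_coe H x₀ t y
  rw [heq] at e1
  have h12 := congrArg (fun L => L w) (hasMFDerivAt_unique e1 e2)
  have h0 : mfderiv (𝓡 6) 𝓘(ℝ, E 7) ((↑) : Sph 6 → E 7) (H (s, x))
      (mfderiv (𝓡 3) (𝓡 6) (fun y => H (s, y)) x w) = 0 := by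
    refine Eq.trans h12.symm ?_
    refine Eq.trans ?_ hv
    rw [← hw]
    rfl
  have hw0 : w = 0 := by
    apply (hemb s).2.2 x
    apply mfderiv_coe_Sph_injective (H (s, x))
    rw [h0, map_zero, map_zero]
  rw [← hw, hw0]
  exact map_zero _

/-- The family of maps into the orthogonal complement of `q` obtained from a family of maps of
spheres by stereographic projection from `q`. -/
def stereoIsotopy (H : Set.Icc (0 : ℝ) 1 × Sph 3 → Sph 6) (x₀ : Sph 3) (q : E 7)
    (p : ℝ × E 4) : (ℝ ∙ q)ᗮ :=
  stereoToFun q (isotopyExtension H x₀ p)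

theorem contDiffAt_stereoIsotopy {H : Set.Icc (0 : ℝ) 1 × Sph 3 → Sph 6}
    (hH : ContMDiff ((𝓡∂ 1).prod (𝓡 3)) (𝓡 6) 1 H) (x₀ : Sph 3) {q : E 7} (hq : ‖q‖ = 1)
    {t : ℝ} {x : E 4} (hx : x ≠ 0) (hTq : isotopyExtension H x₀ (t, x) ≠ q) :
    ContDiffAt ℝ 1 (stereoIsotopy H x₀ q) (t, x) := by
  have hopen : IsOpen {y : E 7 | innerSL ℝ q y ≠ 1} :=
    isOpen_ne_fun (innerSL ℝ q).continuous continuous_const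
  have hmem : isotopyExtension H x₀ (t, x) ∈ {y : E 7 | innerSL ℝ q y ≠ 1} := by
    have hn : ‖isotopyExtension H x₀ (t, x)‖ = 1 := norm_eq_of_mem_sphere _
    intro h
    exact hTq ((inner_eq_one_iff_of_norm_eq_one hq hn).1 h).symm
  exact ((contDiffOn_stereoToFun (n := 1)).contDiffAt (hopen.mem_nhds hmem)).comp (t, x)
    (contDiffAt_isotopyExtension hH x₀ t hx)

theorem stereoInvFun_stereoIsotopy {H : Set.Icc (0 : ℝ) 1 × Sph 3 → Sph 6} {x₀ : Sph 3} {q : E 7}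
    (hq : ‖q‖ = 1) {p : ℝ × E 4} (hp : isotopyExtension H x₀ p ≠ q) :
    (stereoInvFun hq (stereoIsotopy H x₀ q p) : E 7) = isotopyExtension H x₀ p :=
  congrArg Subtype.val (stereo_left_inv hq
    (x := H (projIcc 0 1 zero_le_one (Real.smoothTransition p.1), sphereProj x₀ p.2)) hp)

theorem exists_homeomorph_stereoIsotopy {H : Set.Icc (0 : ℝ) 1 × Sph 3 → Sph 6}
    (hH : ContMDiff ((𝓡∂ 1).prod (𝓡 3)) (𝓡 6) 1 H)
    (hemb : ∀ t, IsSmoothEmbedding fun x => H (t, x)) (x₀ : Sph 3) {q : E 7} (hq : ‖q‖ = 1)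
    (hTq : ∀ t x, x ≠ 0 → isotopyExtension H x₀ (t, x) ≠ q) (s t : ℝ) :
    ∃ Φ : (ℝ ∙ q)ᗮ ≃ₜ (ℝ ∙ q)ᗮ, ∀ x ∈ Sph 3,
      Φ (stereoIsotopy H x₀ q (s, x)) = stereoIsotopy H x₀ q (t, x) := by
  refine exists_homeomorph_of_isotopy (isCompact_sphere (0 : E 4) 1)
    (G' := fderiv ℝ (stereoIsotopy H x₀ q)) (N := fun x : E 4 => ‖x‖ ^ 2)
    (N' := fun x => 2 • innerSL ℝ x) ?_ ?_ (fun x _ => hasStrictFDerivAt_norm_sq x) ?_ ?_ s t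
  · intro t x hx
    have hx0 := coe_sphere_ne_zero ⟨x, hx⟩
    exact (contDiffAt_stereoIsotopy hH x₀ hq hx0 (hTq t x hx0)).hasStrictFDerivAt one_ne_zero
  · have key : ∀ (t : ℝ) (x y : Sph 3), stereoIsotopy H x₀ q (t, x) = stereoIsotopy H x₀ q (t, y) →
        x = y := by
      intro t x y hxy
      have hx := stereoInvFun_stereoIsotopy hq (hTq t x (coe_sphere_ne_zero x))
      have hy := stereoInvFun_stereoIsotopy hq (hTq t y (coe_sphere_ne_zero y))
      rw [hxy, hy, isotopyExtension_coe, isotopyExtension_coe] at hx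
      exact (hemb _).2.1.injective (Subtype.ext hx.symm)
    intro t x hx y hy hxy
    exact congrArg Subtype.val (key t ⟨x, hx⟩ ⟨y, hy⟩ hxy)
  · intro x hx y hy
    rw [mem_sphere_zero_iff_norm.1 hx, mem_sphere_zero_iff_norm.1 hy]
  · intro t x hx v hv hxv
    have hx0 := coe_sphere_ne_zero ⟨x, hx⟩
    refine eq_zero_of_fderiv_isotopyExtension hH hemb x₀ t ⟨x, hx⟩ ?_ (by simpa using hxv)
    have hA : Differentiable ℝ (fun w : (ℝ ∙ q)ᗮ => stereoInvFunAux q (w : E 7)) :=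
      ((contDiff_stereoInvFunAux (m := 1)).comp
        (ℝ ∙ q)ᗮ.subtypeL.contDiff).differentiable one_ne_zero
    have hG := (contDiffAt_stereoIsotopy hH x₀ hq hx0 (hTq t x hx0)).differentiableAt one_ne_zero
    have hcomp := (hA _).hasFDerivAt.comp (t, x) hG.hasFDerivAt
    have heq : isotopyExtension H x₀ =ᶠ[𝓝 (t, x)]
        (fun w : (ℝ ∙ q)ᗮ => stereoInvFunAux q (w : E 7)) ∘ stereoIsotopy H x₀ q := by
      have hne : ∀ᶠ p : ℝ × E 4 in 𝓝 (t, x), p.2 ≠ 0 :=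
        continuousAt_snd.eventually_ne hx0
      filter_upwards [hne] with p hp
      exact (stereoInvFun_stereoIsotopy hq (hTq p.1 p.2 hp)).symm
    rw [(hcomp.congr_of_eventuallyEq heq).fderiv, ContinuousLinearMap.comp_apply, hv, map_zero]

end

open Filter Topology Set Metric in
theorem statement10 (f : Sph 3 → Sph 6) (hf : IsSmoothEmbedding f)
    (hpos : ∀ x, 0 < (f x : E 7) 0)
    (hiso : ∃ (H : Set.Icc (0 : ℝ) 1 × Sph 3 → Sph 6) (g : Sph 3 → Sph 6),
      IsIsotopy H f g ∧ ∀ x : Sph 3, (g x : E 7) = iotaFun (x : E 4)) :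
    ∃ φ : (Metric.closedBall (0 : E 4) 1) → E 7,
      Continuous φ ∧ Function.Injective φ ∧
      (∀ x, φ x ∈ Metric.sphere (0 : E 7) 1 ∧ 0 < φ x 0) ∧
      (∀ (x : E 4) (hx : x ∈ Sph 3),
        φ ⟨x, Metric.sphere_subset_closedBall hx⟩ = (f ⟨x, hx⟩ : E 7)) := by
  obtain ⟨H, g, ⟨hH, hemb, hH0, hH1⟩, hg⟩ := hiso
  have hH' : ContMDiff ((𝓡∂ 1).prod (𝓡 3)) (𝓡 6) 1 H := hH.of_le (by simp)
  obtain ⟨x₀⟩ : Nonempty (Sph 3) := (NormedSpace.sphere_nonempty.2 zero_le_one).to_subtype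
  obtain ⟨q, hq, hq0, hTq⟩ := exists_norm_eq_one_forall_ne
    (fun t x hx => contDiffAt_isotopyExtension hH' x₀ t hx)
  have hT0 : ∀ x : Sph 3, isotopyExtension H x₀ (0, x) = f x := fun x => by
    rw [isotopyExtension_coe, ← hH0]
    simp
  have hT1 : ∀ x : Sph 3, isotopyExtension H x₀ (1, x) = iotaFun x := fun x => by
    rw [isotopyExtension_coe, ← hg, ← hH1]
    simp
  obtain ⟨Φ, hΦ⟩ := exists_homeomorph_stereoIsotopy hH' hemb x₀ hq hTq 1 0
  obtain ⟨d, hdc, hdi, hd, hdb⟩ := exists_disk_iotaFun (q := q) (fun x hx =>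
    hT1 ⟨x, hx⟩ ▸ hTq 1 x (coe_sphere_ne_zero ⟨x, hx⟩))
  have hd' : ∀ x, (stereoInvFun hq (stereoToFun q (d x)) : E 7) = d x := fun x =>
    congrArg Subtype.val (stereo_left_inv hq (x := ⟨d x, (hd x).1⟩) (hd x).2)
  obtain ⟨c, R, hR, hball⟩ := exists_mem_ball_iff_pos_stereoInvFun hq hq0
  have hS0 : ∀ x : Sph 3, (stereoInvFun hq (stereoIsotopy H x₀ q (0, x)) : E 7) = f x := fun x =>
    (stereoInvFun_stereoIsotopy hq (hTq 0 x (coe_sphere_ne_zero x))).trans (hT0 x)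
  have hK : IsCompact ((fun x : E 4 => stereoIsotopy H x₀ q (0, x)) '' Sph 3) := by
    refine (isCompact_sphere _ _).image_of_continuousOn fun x hx => ContinuousAt.continuousWithinAt ?_
    have hx0 := coe_sphere_ne_zero ⟨x, hx⟩
    exact ContinuousAt.comp' (f := fun x : E 4 => ((0 : ℝ), x))
      (contDiffAt_stereoIsotopy hH' x₀ hq hx0 (hTq 0 x hx0)).continuousAt (by fun_prop)
  obtain ⟨C, hCc, hCi, hCb, hCK⟩ := exists_continuous_injective_mem_ball hK (c := c) (R := R) (by
    rintro _ ⟨x, hx, rfl⟩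
    rw [hball, hS0 ⟨x, hx⟩]
    exact hpos _) hR
  refine ⟨fun x => stereoInvFun hq (C (Φ (stereoToFun q (d x)))), ?_, ?_, ?_, ?_⟩
  · refine continuous_subtype_val.comp ((continuous_stereoInvFun hq).comp
      (hCc.comp (Φ.continuous.comp ?_)))
    refine continuousOn_stereoToFun.comp_continuous hdc fun x h => (hd x).2 ?_
    have hn : ‖d x‖ = 1 := mem_sphere_zero_iff_norm.1 (hd x).1
    exact ((inner_eq_one_iff_of_norm_eq_one hq hn).1 h).symm
  · intro x y hxy
    have h := congrArg (stereoToFun q) hxy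
    rw [stereo_right_inv, stereo_right_inv] at h
    have h := Φ.injective (hCi h)
    have h := congrArg (fun w => (stereoInvFun hq w : E 7)) h
    simp only [hd'] at h
    exact hdi h
  · exact fun x => ⟨(stereoInvFun hq _).2, (hball _).1 (hCb _)⟩
  · intro x hx
    have hdx : d ⟨x, sphere_subset_closedBall hx⟩ = isotopyExtension H x₀ (1, x) :=
      (hdb ⟨x, sphere_subset_closedBall hx⟩ hx).trans (hT1 ⟨x, hx⟩).symm
    have hΦx : Φ (stereoToFun q (d ⟨x, sphere_subset_closedBall hx⟩)) =
        stereoIsotopy H x₀ q (0, x) :=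
      (congrArg (fun y => Φ (stereoToFun q y)) hdx).trans (hΦ x hx)
    have hCx : C (Φ (stereoToFun q (d ⟨x, sphere_subset_closedBall hx⟩))) =
        stereoIsotopy H x₀ q (0, x) :=
      (congrArg C hΦx).trans (hCK _ ⟨x, hx, rfl⟩)
    exact (congrArg (fun w => (stereoInvFun hq w : E 7)) hCx).trans (hS0 ⟨x, hx⟩)
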